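/- The polynomial Δ₉(t) is irreducible in ℚ(ω)[t], where ω is a primitive 13th root of unity. -/

import Mathlib

open Polynomial

/-- The coefficient `c₁` of the twisted Alexander polynomial `Δ₃` of `8₁₇`. -/
noncomputable def c₁ (ω : CyclotomicField 13 ℚ) : CyclotomicField 13 ℚ :=
  2 * ω + 2 * ω ^ 2 + 2 * ω ^ 3 + 4 * ω ^ 4 + 2 * ω ^ 5 + 2 * ω ^ 6 + ω ^ 7 + ω ^ 8 +
    2 * ω ^ 9 + 4 * ω ^ 10 + ω ^ 11 + 4 * ω ^ 12

/-- The coefficient `c₂` of the twisted Alexander polynomial `Δ₃` of `8₁₇`. -/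
noncomputable def c₂ (ω : CyclotomicField 13 ℚ) : CyclotomicField 13 ℚ :=
  -15 * ω - 10 * ω ^ 2 - 15 * ω ^ 3 - 15 * ω ^ 4 - 10 * ω ^ 5 - 10 * ω ^ 6 - 10 * ω ^ 7 -
    10 * ω ^ 8 - 15 * ω ^ 9 - 15 * ω ^ 10 - 10 * ω ^ 11 - 15 * ω ^ 12

/-- The coefficient `c₃` of the twisted Alexander polynomial `Δ₃` of `8₁₇`. -/
noncomputable def c₃ (ω : CyclotomicField 13 ℚ) : CyclotomicField 13 ℚ :=
  4 * ω + ω ^ 2 + 4 * ω ^ 3 + 2 * ω ^ 4 + ω ^ 5 + ω ^ 6 + 2 * ω ^ 7 + 2 * ω ^ 8 +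
    4 * ω ^ 9 + 2 * ω ^ 10 + 2 * ω ^ 11 + 2 * ω ^ 12

/-- The twisted Alexander polynomial `Δ₃(t)` of `8₁₇` (with the factor `1 - t` removed). -/
noncomputable def Δ₃ (ω : CyclotomicField 13 ℚ) : Polynomial (CyclotomicField 13 ℚ) :=
  C 1 + C (c₁ ω) * X + C (c₂ ω) * X ^ 2 + C (c₃ ω) * X ^ 3 + X ^ 4

/-- The coefficient `d₁` of the twisted Alexander polynomial `Δ₉` of `8₁₇`. -/
noncomputable def d₁ (ω : CyclotomicField 13 ℚ) : CyclotomicField 13 ℚ :=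
  6 * ω + 5 * ω ^ 2 + 6 * ω ^ 3 + 6 * ω ^ 4 + 5 * ω ^ 5 + 5 * ω ^ 6 + 5 * ω ^ 7 +
    5 * ω ^ 8 + 6 * ω ^ 9 + 6 * ω ^ 10 + 5 * ω ^ 11 + 6 * ω ^ 12

/-- The coefficient `d₂` of the twisted Alexander polynomial `Δ₉` of `8₁₇`. -/
noncomputable def d₂ (ω : CyclotomicField 13 ℚ) : CyclotomicField 13 ℚ :=
  -13 * ω - 12 * ω ^ 2 - 13 * ω ^ 3 - 13 * ω ^ 4 - 12 * ω ^ 5 - 12 * ω ^ 6 - 12 * ω ^ 7 -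
    12 * ω ^ 8 - 13 * ω ^ 9 - 13 * ω ^ 10 - 12 * ω ^ 11 - 13 * ω ^ 12

/-- The twisted Alexander polynomial `Δ₉(t)` of `8₁₇` (with the factor `1 - t` removed). -/
noncomputable def Δ₉ (ω : CyclotomicField 13 ℚ) : Polynomial (CyclotomicField 13 ℚ) :=
  C 1 + C (d₁ ω) * X + C (d₂ ω) * X ^ 2 + C (d₁ ω) * X ^ 3 + X ^ 4

/-- A monic quartic over a domain is irreducible as soon as it has no root and is not a product of
two monic quadratics. -/
theorem irreducible_quartic {R : Type*} [CommRing R] [IsDomain R] {a b c d : R}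
    (hroot : ∀ t : R, d + c * t + b * t ^ 2 + a * t ^ 3 + t ^ 4 ≠ 0)
    (hquad : ∀ x y z w : R, x + z = a → y + w + x * z = b → x * w + y * z = c → y * w ≠ d) :
    Irreducible (C d + C c * X + C b * X ^ 2 + C a * X ^ 3 + X ^ 4 : R[X]) := by
  set p : R[X] := C d + C c * X + C b * X ^ 2 + C a * X ^ 3 + X ^ 4 with hp
  have hdeg : p.natDegree = 4 := by rw [hp]; compute_degree!
  have hmonic : p.Monic := by rw [hp]; monicity!
  rw [hmonic.irreducible_iff_natDegree']
  refine ⟨fun h => by simp [h] at hdeg, fun f g hf hg hfg hmem => ?_⟩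
  have hsum : f.natDegree + g.natDegree = 4 := by rw [← hf.natDegree_mul hg, hfg, hdeg]
  rw [hdeg, Finset.mem_Ioc] at hmem
  obtain hg1 | hg2 : g.natDegree = 1 ∨ g.natDegree = 2 := by omega
  · have hgX := hg.as_sum
    rw [hg1] at hgX
    have heval := congrArg (eval (-g.coeff 0)) hfg
    rw [eval_mul, hgX] at heval
    simp [hp] at heval
    exact hroot (-g.coeff 0) (by simpa using heval.symm)
  · have hf2 : f.natDegree = 2 := by omega
    have hfX := hf.as_sum
    have hgX := hg.as_sum
    rw [hf2] at hfX
    rw [hg2] at hgX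
    simp only [Finset.sum_range_succ, Finset.sum_range_zero, pow_zero, pow_one, mul_one,
      zero_add] at hfX hgX
    generalize f.coeff 0 = y, f.coeff 1 = x at hfX
    generalize g.coeff 0 = w, g.coeff 1 = z at hgX
    have hprod : C (y * w) + C (x * w + y * z) * X + C (y + w + x * z) * X ^ 2 +
        C (x + z) * X ^ 3 + X ^ 4 = p := by
      rw [← hfg, hfX, hgX]
      simp only [map_add, map_mul]
      ring
    have hcoeff (n : ℕ) := congrArg (coeff · n) hprod
    have h0 := hcoeff 0
    have h1 := hcoeff 1
    have h2 := hcoeff 2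
    have h3 := hcoeff 3
    simp [hp, coeff_X, coeff_X_pow, coeff_C, -map_add, -map_mul] at h0 h1 h2 h3
    exact hquad x y z w h3 h2 h1 h0

theorem irreducible_quartic_zmod_53 :
    Irreducible (C 1 + C 2 * X + C 5 * X ^ 2 + C 2 * X ^ 3 + X ^ 4 : (ZMod 53)[X]) := by
  have key : ∀ x y : ZMod 53, x * (5 - y - x * (2 - x)) + y * (2 - x) = 2 →
      y * (5 - y - x * (2 - x)) ≠ 1 := by decide +kernel
  have hroot : ∀ t : ZMod 53, 1 + 2 * t + 5 * t ^ 2 + 2 * t ^ 3 + t ^ 4 ≠ 0 := by decide +kernel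
  have : Fact (Nat.Prime 53) := ⟨by norm_num⟩
  refine irreducible_quartic hroot fun x y z w hxz hyw hlin hconst => ?_
  obtain rfl : z = 2 - x := by linear_combination hxz
  obtain rfl : w = 5 - y - x * (2 - x) := by linear_combination hyw
  exact key x y hlin hconst

/-- The ring of integers of a cyclotomic field maps to any ring containing a root of the cyclotomic
polynomial, sending the given primitive root of unity to that root. -/
theorem exists_ringOfIntegers_hom {n : ℕ} [NeZero n] {K : Type*} [Field K] [NumberField K]
    [IsCyclotomicExtension {n} ℚ K] {ζ : K} (hζ : IsPrimitiveRoot ζ n) {R : Type*} [CommRing R]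
    {r : R} (hr : eval₂ (Int.castRingHom R) r (cyclotomic n ℤ) = 0) :
    ∃ φ : NumberField.RingOfIntegers K →+* R, φ hζ.toInteger = r := by
  have hmin : aeval r (minpoly ℤ hζ.integralPowerBasis.gen) = 0 := by
    rw [hζ.integralPowerBasis_gen, ← NumberField.RingOfIntegers.minpoly_coe,
      show (hζ.toInteger : K) = ζ from rfl, ← cyclotomic_eq_minpoly hζ (NeZero.pos n)]
    exact hr
  refine ⟨(hζ.integralPowerBasis.lift r hmin).toRingHom, ?_⟩
  have h := hζ.integralPowerBasis.lift_gen r hmin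
  rw [hζ.integralPowerBasis_gen] at h
  exact h

/-- The twisted Alexander polynomial `Δ₉(t)` of `8₁₇` is irreducible in `ℚ(ω)[t]`, where `ω`
is a primitive 13th root of unity. -/
theorem Δ₉_irreducible (ω : CyclotomicField 13 ℚ) (hω : IsPrimitiveRoot ω 13) :
    Irreducible (Δ₉ ω) := by
  have : @IsCyclotomicExtension {13} ℚ (CyclotomicField 13 ℚ) _ _ DivisionRing.toRatAlgebra := by
    rw [Subsingleton.elim DivisionRing.toRatAlgebra (CyclotomicField.algebra 13 ℚ)]
    exact CyclotomicField.isCyclotomicExtension 13 ℚ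
  obtain ⟨φ, hφ⟩ := exists_ringOfIntegers_hom hω (R := ZMod 53) (r := 13) (by
    have : Fact (Nat.Prime 13) := ⟨by norm_num⟩
    rw [cyclotomic_prime]
    simp only [eval₂_finsetSum, eval₂_pow, eval₂_X]
    decide +kernel)
  set μ := hω.toInteger
  have hμ : algebraMap (NumberField.RingOfIntegers (CyclotomicField 13 ℚ)) _ μ = ω := rfl
  let e₁ := 6 * μ + 5 * μ ^ 2 + 6 * μ ^ 3 + 6 * μ ^ 4 + 5 * μ ^ 5 + 5 * μ ^ 6 + 5 * μ ^ 7 +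
    5 * μ ^ 8 + 6 * μ ^ 9 + 6 * μ ^ 10 + 5 * μ ^ 11 + 6 * μ ^ 12
  let e₂ := -13 * μ - 12 * μ ^ 2 - 13 * μ ^ 3 - 13 * μ ^ 4 - 12 * μ ^ 5 - 12 * μ ^ 6 -
    12 * μ ^ 7 - 12 * μ ^ 8 - 13 * μ ^ 9 - 13 * μ ^ 10 - 12 * μ ^ 11 - 13 * μ ^ 12
  let P := C 1 + C e₁ * X + C e₂ * X ^ 2 + C e₁ * X ^ 3 + X ^ 4
  have hmonic : P.Monic := by simp only [P]; monicity!
  have hmap : P.map (algebraMap _ (CyclotomicField 13 ℚ)) = Δ₉ ω := by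
    have h₁ : algebraMap _ _ e₁ = d₁ ω := by
      simp only [e₁, d₁, map_add, map_mul, map_pow, map_ofNat, hμ]
    have h₂ : algebraMap _ _ e₂ = d₂ ω := by
      simp only [e₂, d₂, map_sub, map_neg, map_mul, map_pow, map_ofNat, hμ]
    simp only [P, Δ₉, Polynomial.map_add, Polynomial.map_mul, Polynomial.map_pow, map_C, map_X, h₁,
      h₂, map_one, Polynomial.map_one]
  have hφ₁ : φ e₁ = 2 := by
    simp only [e₁, map_add, map_mul, map_pow, map_ofNat, hφ]
    decide +kernel
  have hφ₂ : φ e₂ = 5 := by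
    simp only [e₂, map_sub, map_neg, map_mul, map_pow, map_ofNat, hφ]
    decide +kernel
  have : Fact (Nat.Prime 53) := ⟨by norm_num⟩
  rw [← hmap, ← hmonic.irreducible_iff_irreducible_map_fraction_map]
  refine hmonic.irreducible_of_irreducible_map φ P ?_
  have hmapφ : P.map φ = C 1 + C 2 * X + C 5 * X ^ 2 + C 2 * X ^ 3 + X ^ 4 := by
    simp only [P, Polynomial.map_add, Polynomial.map_mul, Polynomial.map_pow, map_C, map_X, hφ₁,
      hφ₂, map_one, Polynomial.map_one]
  rw [hmapφ]
  exact irreducible_quartic_zmod_53
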